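/- Let c ∈ (0,1) and let f : (c,1) → ℝ with f′ locally absolutely continuous on (c,1) (so f″ exists a.e.). If lim_{x→1⁻}(1−x)²f″(x) = 0, then lim_{x→1⁻}(1−x²)f′(x) = 0. -/

import Mathlib

open MeasureTheory Set Filter

noncomputable section

/-- `f` is locally absolutely continuous on the set `s` with a.e. derivative `f'`,
expressed via the fundamental theorem of calculus. -/
def LocACOnI (f f' : ℝ → ℝ) (s : Set ℝ) : Prop :=
  ∀ x ∈ s, ∀ y ∈ s,
    IntervalIntegrable f' volume x y ∧ f y - f x = ∫ t in x..y, f' t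

/-- A locally absolutely continuous function whose derivative is bounded by `δ / (1 - t)²` on
`(a, x]`, with `x < 1`, changes by at most `δ / (1 - x)` from `a` to `x`. -/
theorem LocACOnI.abs_sub_le_div_one_sub {g g' : ℝ → ℝ} {s : Set ℝ} (hg : LocACOnI g g' s)
    {a x δ : ℝ} (ha : a ∈ s) (hx : x ∈ s) (hax : a ≤ x) (hx1 : x < 1) (hδ : 0 ≤ δ)
    (hb : ∀ t ∈ Ioc a x, |(1 - t) ^ 2 * g' t| ≤ δ) :
    |g x - g a| ≤ δ / (1 - x) := by
  have hne : ∀ t ∈ uIcc a x, 1 - t ≠ 0 := fun t ht => by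
    rw [uIcc_of_le hax] at ht
    linarith [ht.2]
  have hint : IntervalIntegrable (fun t : ℝ => δ / (1 - t) ^ 2) volume a x :=
    ContinuousOn.intervalIntegrable <| ContinuousOn.div (by fun_prop) (by fun_prop)
      fun t ht => pow_ne_zero 2 (hne t ht)
  have hderiv : ∀ t ∈ uIcc a x, HasDerivAt (fun t : ℝ => δ / (1 - t)) (δ / (1 - t) ^ 2) t := by
    intro t ht
    refine ((hasDerivAt_const t δ).fun_div ((hasDerivAt_id' t).const_sub 1)
      (hne t ht)).congr_deriv ?_
    ring
  have hbound : |g x - g a| ≤ ∫ t in a..x, δ / (1 - t) ^ 2 := by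
    rw [(hg a ha x hx).2, ← Real.norm_eq_abs]
    refine intervalIntegral.norm_integral_le_of_norm_le hax (ae_of_all _ fun t ht => ?_) hint
    have hpos : 0 < (1 - t) ^ 2 := pow_pos (by linarith [ht.2]) 2
    have hbt := hb t ht
    rw [abs_mul, abs_of_pos hpos] at hbt
    rwa [Real.norm_eq_abs, le_div_iff₀ hpos, mul_comm]
  rw [intervalIntegral.integral_eq_sub_of_hasDerivAt hderiv hint] at hbound
  have : 0 ≤ δ / (1 - a) := div_nonneg hδ (by linarith)
  linarith

/-- Let `c ∈ (0,1)` and `f : (c,1) → ℝ` with `f′` locally absolutely continuous.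
If `lim_{x→1⁻} (1-x)²f″(x) = 0`, then `lim_{x→1⁻} (1-x²)f′(x) = 0`. -/
theorem first_deriv_limit_of_second_deriv_limit (c : ℝ) (hc : c ∈ Ioo (0:ℝ) 1)
    (f f' f'' : ℝ → ℝ)
    (hf : LocACOnI f f' (Ioo c 1)) (hf' : LocACOnI f' f'' (Ioo c 1))
    (h : Tendsto (fun x => (1 - x)^2 * f'' x) (nhdsWithin 1 (Ioo c 1)) (nhds 0)) :
    Tendsto (fun x => (1 - x^2) * f' x) (nhdsWithin 1 (Ioo c 1)) (nhds 0) := by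
  rw [Metric.tendsto_nhds]
  intro ε hε
  have hsmall : ∀ᶠ x in nhdsWithin 1 (Ioo c 1), |(1 - x) ^ 2 * f'' x| < ε / 4 := by
    simpa [Real.dist_eq] using (Metric.tendsto_nhds.1 h) (ε / 4) (by positivity)
  rw [nhdsWithin_Ioo_eq_nhdsLT hc.2] at hsmall ⊢
  obtain ⟨b, hb1, hb⟩ := mem_nhdsLT_iff_exists_Ioo_subset.1 hsmall
  obtain ⟨a, hba, ha1⟩ := exists_between (max_lt hb1 hc.2)
  have hca : c < a := (le_max_right _ _).trans_lt hba
  have hlim : Tendsto (fun x : ℝ => 2 * (1 - x) * |f' a|) (nhdsWithin 1 (Iio 1)) (nhds 0) := by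
    have hcont : Continuous fun x : ℝ => 2 * (1 - x) * |f' a| := by fun_prop
    simpa using (hcont.tendsto 1).mono_left nhdsWithin_le_nhds
  filter_upwards [hlim.eventually_lt_const (half_pos hε), Ioo_mem_nhdsLT ha1] with x hx hxa
  have hx0 : 0 < 1 - x := sub_pos.2 hxa.2
  have hgrow : |f' x - f' a| ≤ ε / 4 / (1 - x) :=
    hf'.abs_sub_le_div_one_sub ⟨hca, ha1⟩ ⟨hca.trans hxa.1, hxa.2⟩ hxa.1.le hxa.2 (by positivity)
      fun t ht => (hb ⟨((le_max_left _ _).trans_lt hba).trans ht.1, ht.2.trans_lt hxa.2⟩).le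
  rw [le_div_iff₀ hx0] at hgrow
  have htri : |f' x| ≤ |f' x - f' a| + |f' a| := by
    simpa using abs_add_le (f' x - f' a) (f' a)
  have hfac : |1 - x ^ 2| ≤ 2 * (1 - x) := by
    have : 0 < x := hc.1.trans (hca.trans hxa.1)
    rw [abs_of_nonneg] <;> nlinarith [hxa.2]
  rw [Real.dist_eq, sub_zero, abs_mul]
  calc |1 - x ^ 2| * |f' x| ≤ 2 * (1 - x) * (|f' x - f' a| + |f' a|) := by gcongr
    _ < ε := by linarith
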